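/- arXiv:2510.15551 — 6 statements merged into one kernel-verified Lean document; each statement's English description precedes it below -/
import Mathlib

section
/- Let m ≥ 2 and let μ : Fin m → ℝ have a unique argmax i*, with μ₀ = μ(i*) and μ₁ = max_{j ≠ i*} μ(j). Let s > 0 and let z be drawn from N(μ, s²I), the product of independent real Gaussian measures with the i-th coordinate having mean μ(i) and variance s². Then the probability that z(i*) strictly exceeds every other coordinate satisfies P(∀ j ≠ i*, z(i*) > z(j)) ≥ 1 − (m−1)·(1 − Φ((μ₀ − μ₁)/(s·√2))). (Source-confidence lower bound of Proposition 3, with s² = σ_s² + 2 in the paper's parametrization, in union-bound form.) -/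
open MeasureTheory ProbabilityTheory

/-- The cumulative distribution function of the standard real Gaussian measure. -/
noncomputable def stdGaussianCDF (x : ℝ) : ℝ :=
  (gaussianReal 0 1 (Set.Iic x)).toReal

/-- A real Gaussian of positive variance `σ²` and mean `m` is positive with probability
`Φ(m / σ)`. -/
lemma gaussianReal_real_Ioi_zero (m : ℝ) {v : NNReal} {σ : ℝ} (hσ : 0 < σ)
    (hv : (v : ℝ) = σ ^ 2) :
    (gaussianReal m v).real (Set.Ioi 0) = stdGaussianCDF (m / σ) := by
  have hstd : (gaussianReal m v).map (fun x ↦ (m - x) / σ) = gaussianReal 0 1 := by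
    have hcomp : (fun x ↦ (m - x) / σ) = (fun x ↦ x / σ) ∘ (fun x ↦ m - x) := rfl
    rw [hcomp, ← Measure.map_map (by fun_prop) (by fun_prop), gaussianReal_map_const_sub,
      gaussianReal_map_div_const]
    congr 1
    · simp
    · ext
      simp [hv, hσ.ne']
  have hpre : (fun x ↦ (m - x) / σ) ⁻¹' Set.Iio (m / σ) = Set.Ioi 0 := by
    ext x
    simp [div_lt_div_iff_of_pos_right hσ]
  have : NullSingletonClass (gaussianReal 0 1) := nullSingletonClass_gaussianReal one_ne_zero
  rw [stdGaussianCDF, ← measure_congr (Iio_ae_eq_Iic (a := m / σ)), ← hstd,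
    Measure.map_apply (by fun_prop) measurableSet_Iio, hpre, measureReal_def]

/-- The law of the difference of two coordinates under a product of Gaussian measures. -/
lemma map_eval_sub_eval_pi_gaussianReal {ι : Type*} [Fintype ι] (μ : ι → ℝ) (v : ι → NNReal)
    {i j : ι} (hij : i ≠ j) :
    (Measure.pi fun k ↦ gaussianReal (μ k) (v k)).map (fun z ↦ z i - z j) =
      gaussianReal (μ i - μ j) (v i + v j) := by
  have hind : iIndepFun (fun k (z : ι → ℝ) ↦ z k)
      (Measure.pi fun k ↦ gaussianReal (μ k) (v k)) :=
    iIndepFun_pi (X := fun _ ↦ id) fun _ ↦ aemeasurable_id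
  have hlaw (k : ι) : (Measure.pi fun k ↦ gaussianReal (μ k) (v k)).map (fun z ↦ z k) =
      gaussianReal (μ k) (v k) :=
    (measurePreserving_eval _ k).map_eq
  have hneg : (Measure.pi fun k ↦ gaussianReal (μ k) (v k)).map (fun z ↦ -z j) =
      gaussianReal (-μ j) (v j) := by
    have hcomp : (fun z : ι → ℝ ↦ -z j) = (fun x ↦ -x) ∘ (fun z ↦ z j) := rfl
    rw [hcomp, ← Measure.map_map (by fun_prop) (by fun_prop), hlaw, gaussianReal_map_neg]
  have hadd := gaussianReal_add_gaussianReal_of_indepFun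
    ((hind.indepFun hij).comp measurable_id measurable_neg) (hlaw i) hneg
  simp only [sub_eq_add_neg]
  exact hadd

lemma monotone_stdGaussianCDF : Monotone stdGaussianCDF := fun _ _ h ↦
  measureReal_mono (Set.Iic_subset_Iic.2 h)

/-- Source-confidence lower bound of Proposition 3 (union-bound form): if `z` is drawn from
the product of independent Gaussians `N(μ i, s²)` and `istar` is the unique argmax of `μ`,
then the probability that `z istar` strictly exceeds every other coordinate is at least
`1 - (m-1)·(1 - Φ((μ₀ - μ₁)/(s·√2)))`, where `μ₀ = μ istar` and `μ₁` is the largest of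
the remaining logit means. -/
theorem source_mode_prob_lower_bound {m : ℕ} (hm : 2 ≤ m)
    (μ : Fin m → ℝ) (istar : Fin m)
    (hmax : ∀ j, j ≠ istar → μ j < μ istar)
    (s : ℝ) (hs : 0 < s) :
    1 - (m - 1 : ℝ) *
        (1 - stdGaussianCDF ((μ istar -
            (Finset.univ.erase istar).sup'
              (by
                rw [← Finset.card_pos, Finset.card_erase_of_mem (Finset.mem_univ _),
                  Finset.card_univ, Fintype.card_fin]
                omega) μ) / (s * Real.sqrt 2)))
      ≤ ((Measure.pi fun i : Fin m => gaussianReal (μ i) ⟨s ^ 2, sq_nonneg s⟩)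
          {z | ∀ j, j ≠ istar → z j < z istar}).toReal := by
  obtain ⟨v, hv, hpi⟩ : ∃ v : NNReal, (v : ℝ) = s ^ 2 ∧
      (Measure.pi fun i : Fin m => gaussianReal (μ i) ⟨s ^ 2, sq_nonneg s⟩) =
        Measure.pi fun i => gaussianReal (μ i) v := ⟨⟨s ^ 2, sq_nonneg s⟩, rfl, rfl⟩
  rw [hpi]
  set P := Measure.pi fun i : Fin m => gaussianReal (μ i) v with hP
  set S := Finset.univ.erase istar
  generalize_proofs hS
  set t := (μ istar - S.sup' hS μ) / (s * Real.sqrt 2)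
  have hσ : 0 < s * Real.sqrt 2 := by positivity
  have hpair : ∀ j ∈ S, P.real {z | z j < z istar}ᶜ ≤ 1 - stdGaussianCDF t := by
    intro j hj
    have hmeas : MeasurableSet {z : Fin m → ℝ | z j < z istar} :=
      measurableSet_lt (by fun_prop) (by fun_prop)
    have hprob : P.real {z | z j < z istar} =
        stdGaussianCDF ((μ istar - μ j) / (s * Real.sqrt 2)) := by
      have hpre : {z : Fin m → ℝ | z j < z istar} =
          (fun z ↦ z istar - z j) ⁻¹' Set.Ioi 0 := by
        ext z
        simp
      rw [hpre, ← map_measureReal_apply (by fun_prop) measurableSet_Ioi, hP,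
        map_eval_sub_eval_pi_gaussianReal μ (fun _ ↦ v) (Finset.ne_of_mem_erase hj).symm]
      refine gaussianReal_real_Ioi_zero _ hσ ?_
      rw [mul_pow, Real.sq_sqrt zero_le_two, mul_two, NNReal.coe_add, hv]
    rw [probReal_compl_eq_one_sub hmeas, hprob]
    have hle : t ≤ (μ istar - μ j) / (s * Real.sqrt 2) := by
      have := Finset.le_sup' μ hj
      simp only [t]
      gcongr
    linarith [monotone_stdGaussianCDF hle]
  have hset : {z : Fin m → ℝ | ∀ j, j ≠ istar → z j < z istar}ᶜ =
      ⋃ j ∈ S, {z | z j < z istar}ᶜ := by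
    ext z
    simp [S]
  have hmeas : MeasurableSet {z : Fin m → ℝ | ∀ j, j ≠ istar → z j < z istar} := by
    measurability
  have hcard : (S.card : ℝ) = m - 1 := by
    rw [Finset.card_erase_of_mem (Finset.mem_univ _), Finset.card_univ, Fintype.card_fin,
      Nat.cast_pred (by omega)]
  have hunion : P.real {z | ∀ j, j ≠ istar → z j < z istar}ᶜ ≤
      (m - 1 : ℝ) * (1 - stdGaussianCDF t) := by
    rw [hset, ← hcard, ← nsmul_eq_mul]
    exact (measureReal_biUnion_finset_le _ _).trans (Finset.sum_le_card_nsmul _ _ _ hpair)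
  rw [probReal_compl_eq_one_sub hmeas] at hunion
  rw [← measureReal_def]
  linarith
end

section
/- Let m ≥ 2 and let μ : Fin m → ℝ have a unique argmax i*, with μ₀ = μ(i*) and μ₁ = max_{j ≠ i*} μ(j). Let σ ≥ 0, c > 0, τ ≥ 1, η ≥ 1 and let z be drawn from N(μ/τ, (η·σ² + c)·I), the product of independent real Gaussians, the i-th coordinate with mean μ(i)/τ and variance η·σ² + c. Then P(∀ j ≠ i*, z(i*) > z(j)) ≥ 1 − (m−1)·(1 − Φ((μ₀ − μ₁)/(τ·√(2·(η·σ² + c))))). (Target-confidence lower bound of Proposition 3, with c = 2 in the paper's parametrization, in union-bound form: the target logit mean is flattened by τ and the variance inflated by η.) -/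
open MeasureTheory ProbabilityTheory

/-- A nondegenerate Gaussian with mean `a` and variance `v` is negative with probability
`Φ (-a / √v)`. -/
lemma gaussianReal_real_Iio_zero (a : ℝ) {v : NNReal} (hv : v ≠ 0) :
    (gaussianReal a v).real (Set.Iio 0) = stdGaussianCDF (-a / √v) := by
  have hpos : 0 < √(v : ℝ) := Real.sqrt_pos.2 (by exact_mod_cast pos_iff_ne_zero.2 hv)
  have hscale : (gaussianReal 0 1).map (fun x => √(v : ℝ) * x) = gaussianReal 0 v := by
    rw [gaussianReal_map_const_mul]
    congr 1
    · simp
    · ext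
      simp
  have hshift : (gaussianReal 0 1).map (fun x => √(v : ℝ) * x + a) = gaussianReal a v := by
    have h := gaussianReal_map_add_const (μ := 0) (v := v) a
    rw [← hscale, Measure.map_map (by fun_prop) (by fun_prop), zero_add] at h
    exact h
  have hpre : (fun x => √(v : ℝ) * x + a) ⁻¹' Set.Iio 0 = Set.Iio (-a / √v) := by
    ext x
    simp only [Set.mem_preimage, Set.mem_Iio, lt_div_iff₀ hpos]
    constructor <;> intro h <;> linarith
  have := nullSingletonClass_gaussianReal (μ := 0) (v := 1) one_ne_zero
  rw [← hshift, map_measureReal_apply (by fun_prop) measurableSet_Iio, hpre, stdGaussianCDF,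
    Measure.real, measure_congr Iio_ae_eq_Iic]

/-- The difference of two distinct coordinates of a product of real Gaussians is Gaussian. -/
lemma map_sub_pi_gaussianReal {ι : Type*} [Fintype ι] (a : ι → ℝ) (v : ι → NNReal) {i j : ι}
    (hij : i ≠ j) :
    (Measure.pi fun k => gaussianReal (a k) (v k)).map (fun z => z i - z j) =
      gaussianReal (a i - a j) (v i + v j) := by
  have hindep : IndepFun (fun z : ι → ℝ => z i) (fun z => z j)
      (Measure.pi fun k => gaussianReal (a k) (v k)) :=
    (iIndepFun_pi (X := fun _ x => x) fun _ => by fun_prop).indepFun hij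
  have hneg : (Measure.pi fun k => gaussianReal (a k) (v k)).map (fun z => -z j) =
      gaussianReal (-a j) (v j) := by
    rw [← gaussianReal_map_neg,
      ← (measurePreserving_eval (fun k => gaussianReal (a k) (v k)) j).map_eq,
      Measure.map_map (by fun_prop) (by fun_prop)]
    rfl
  rw [sub_eq_add_neg (a i), ← gaussianReal_add_gaussianReal_of_indepFun
    (hindep.comp measurable_id measurable_neg) (measurePreserving_eval _ i).map_eq hneg]
  simp only [sub_eq_add_neg]
  rfl

/-- The probability that one coordinate of a product of real Gaussians with common nonzero variance
is at least another one. -/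
lemma pi_gaussianReal_real_le {ι : Type*} [Fintype ι] (a : ι → ℝ) {v : NNReal} (hv : v ≠ 0)
    {i j : ι} (hij : i ≠ j) :
    (Measure.pi fun k => gaussianReal (a k) v).real {z | z j ≤ z i} =
      1 - stdGaussianCDF ((a j - a i) / √(2 * v)) := by
  have hset : {z : ι → ℝ | z j ≤ z i} = ((fun z => z i - z j) ⁻¹' Set.Iio 0)ᶜ := by
    ext z
    simp
  rw [hset, probReal_compl_eq_one_sub (measurableSet_Iio.preimage (by fun_prop)),
    ← map_measureReal_apply (by fun_prop) measurableSet_Iio,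
    map_sub_pi_gaussianReal a (fun _ => v) hij,
    gaussianReal_real_Iio_zero _ (by simpa using hv), neg_sub, NNReal.coe_add, ← two_mul]

/-- Union bound for the probability that a given coordinate of a product of real Gaussians with
common variance is the strict maximum. -/
lemma one_sub_sum_le_pi_gaussianReal_real {ι : Type*} [Fintype ι] [DecidableEq ι] (a : ι → ℝ)
    {v : NNReal} (hv : v ≠ 0) (i : ι) :
    1 - ∑ j ∈ Finset.univ.erase i, (1 - stdGaussianCDF ((a i - a j) / √(2 * v))) ≤
      (Measure.pi fun k => gaussianReal (a k) v).real {z | ∀ j, j ≠ i → z j < z i} := by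
  have hset : {z : ι → ℝ | ∀ j, j ≠ i → z j < z i} =
      (⋃ j ∈ Finset.univ.erase i, {z | z i ≤ z j})ᶜ := by
    ext z
    simp
  have hmeas : MeasurableSet (⋃ j ∈ Finset.univ.erase i, {z : ι → ℝ | z i ≤ z j}) :=
    Finset.measurableSet_biUnion _ fun j _ => measurableSet_le (by fun_prop) (by fun_prop)
  rw [hset, probReal_compl_eq_one_sub hmeas]
  gcongr
  refine (measureReal_biUnion_finset_le _ _).trans (Finset.sum_le_sum fun j hj => ?_)
  exact (pi_gaussianReal_real_le a hv (Finset.ne_of_mem_erase hj)).le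

/-- Target-confidence lower bound of Proposition 3 (union-bound form): if `z` is drawn from
the product of independent Gaussians `N(μ i / τ, η·σ² + c)` (target logit mean flattened by
`τ ≥ 1`, variance inflated by `η ≥ 1`) and `istar` is the unique argmax of `μ`, then the
probability that `z istar` strictly exceeds every other coordinate is at least
`1 - (m-1)·(1 - Φ((μ₀ - μ₁)/(τ·√(2·(η·σ² + c)))))`, where `μ₀ = μ istar` and `μ₁` is the
largest of the remaining logit means. -/
theorem target_mode_prob_lower_bound {m : ℕ} (hm : 2 ≤ m)
    (μ : Fin m → ℝ) (istar : Fin m)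
    (hmax : ∀ j, j ≠ istar → μ j < μ istar)
    (σ c τ η : ℝ) (hσ : 0 ≤ σ) (hc : 0 < c) (hτ : 1 ≤ τ) (hη : 1 ≤ η) :
    1 - (m - 1 : ℝ) *
        (1 - stdGaussianCDF ((μ istar -
            (Finset.univ.erase istar).sup'
              (by
                rw [← Finset.card_pos, Finset.card_erase_of_mem (Finset.mem_univ _),
                  Finset.card_univ, Fintype.card_fin]
                omega) μ) / (τ * Real.sqrt (2 * (η * σ ^ 2 + c)))))
      ≤ ((Measure.pi fun i : Fin m =>
            gaussianReal (μ i / τ) ⟨η * σ ^ 2 + c, by positivity⟩)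
          {z | ∀ j, j ≠ istar → z j < z istar}).toReal := by
  have hv : 0 < η * σ ^ 2 + c := by positivity
  refine le_trans ?_ (one_sub_sum_le_pi_gaussianReal_real (fun i => μ i / τ)
    (v := NNReal.mk (η * σ ^ 2 + c) hv.le) (fun h => hv.ne' (congrArg NNReal.toReal h)) istar)
  have hcard : ((Finset.univ.erase istar).card : ℝ) = m - 1 := by
    rw [Finset.card_erase_of_mem (Finset.mem_univ _), Finset.card_univ, Fintype.card_fin,
      Nat.cast_pred (by omega)]
  rw [← hcard, ← nsmul_eq_mul]
  gcongr
  refine Finset.sum_le_card_nsmul _ _ _ fun j hj => ?_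
  gcongr
  refine monotone_stdGaussianCDF ?_
  rw [← sub_div, div_div, NNReal.coe_mk]
  gcongr
  exact Finset.le_sup' μ hj
end

section
/- Let m ≥ 2, π ∈ [0,1], τ ≥ 1, and let μ_s, μ_b : Fin m → ℝ be logit vectors with unique argmaxes i* of μ_s and j* of μ_b such that i* ≠ j*. Define the target mixture distribution q_β = π·softmax_{β/τ}(μ_s) + (1−π)·softmax_β(μ_b), a probability mass function on Fin m. Then the agreement probability A(softmax_β(μ_s), q_β) = ∑_i softmax_β(μ_s)(i)·q_β(i) tends to π as β → ∞. (Hence the mixing coefficient π of the paper's bias–variance mixture model of target responses is identified by the source–target agreement in the low-variance limit.) -/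
open Filter

/-- The softmax distribution at inverse temperature `β` of a logit vector `μ : Fin m → ℝ`. -/
noncomputable def softmax {m : ℕ} (β : ℝ) (μ : Fin m → ℝ) (i : Fin m) : ℝ :=
  Real.exp (β * μ i) / ∑ j, Real.exp (β * μ j)

/-- As `β → ∞`, the softmax distribution concentrates on the unique argmax of the logits. -/
theorem tendsto_softmax_atTop {m : ℕ} {μ : Fin m → ℝ} {k : Fin m}
    (hk : ∀ j, j ≠ k → μ j < μ k) (i : Fin m) :
    Tendsto (fun β : ℝ => softmax β μ i) atTop (nhds (if i = k then 1 else 0)) := by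
  have hexp (j : Fin m) :
      Tendsto (fun β : ℝ => Real.exp (β * (μ j - μ k))) atTop
        (nhds (if j = k then 1 else 0)) := by
    by_cases hj : j = k
    · simp [hj]
    · rw [if_neg hj]
      exact Real.tendsto_exp_atBot.comp
        (tendsto_id.atTop_mul_const_of_neg (sub_neg.mpr (hk j hj)))
  have hsum := tendsto_finsetSum Finset.univ fun j _ => hexp j
  rw [Finset.sum_ite_eq' Finset.univ k, if_pos (Finset.mem_univ k)] at hsum
  have hdiv := (hexp i).div hsum one_ne_zero
  rw [div_one] at hdiv
  refine hdiv.congr fun β => ?_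
  simp only [softmax, Pi.div_apply, mul_sub, Real.exp_sub, ← Finset.sum_div]
  exact div_div_div_cancel_right₀ (Real.exp_ne_zero _) _ _

/-- The mixing coefficient `π` of the bias–variance mixture model of target responses is
identified by the source–target agreement in the low-variance limit: the agreement
probability between the source `softmax β μs` and the target mixture
`π • softmax (β/τ) μs + (1-π) • softmax β μb` tends to `π` as `β → ∞`,
provided the unique argmaxes of `μs` and `μb` differ. -/
theorem agreement_tendsto_mixing_coefficient {m : ℕ} (hm : 2 ≤ m)
    (π : ℝ) (hπ0 : 0 ≤ π) (hπ1 : π ≤ 1) (τ : ℝ) (hτ : 1 ≤ τ)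
    (μs μb : Fin m → ℝ) (istar jstar : Fin m)
    (hs : ∀ j, j ≠ istar → μs j < μs istar)
    (hb : ∀ j, j ≠ jstar → μb j < μb jstar)
    (hne : istar ≠ jstar) :
    Tendsto (fun β : ℝ => ∑ i, softmax β μs i *
        (π * softmax (β / τ) μs i + (1 - π) * softmax β μb i)) atTop (nhds π) := by
  have hτ0 : 0 < τ := one_pos.trans_le hτ
  have h := tendsto_finsetSum Finset.univ fun i _ =>
    (tendsto_softmax_atTop hs i).mul
      ((((tendsto_softmax_atTop hs i).comp (tendsto_id.atTop_div_const hτ0)).const_mul π).add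
        ((tendsto_softmax_atTop hb i).const_mul (1 - π)))
  simpa [hne] using h
end

section
/- Let m ≥ 1 and μ : Fin m → ℝ. For 0 ≤ β₁ ≤ β₂, the Shannon entropy satisfies H(softmax_{β₂}(μ)) ≤ H(softmax_{β₁}(μ)), where H(p) = −∑_i p(i)·log p(i). In particular, for every τ ≥ 1 the flattened distribution softmax_{1/τ}(μ) (logits μ/τ) has entropy at least that of softmax_1(μ) (logits μ): dividing the logits by τ ≥ 1 makes the response distribution flatter. -/
/-- The Shannon entropy of a probability mass function on `Fin m`. -/
noncomputable def shannonEntropy {m : ℕ} (p : Fin m → ℝ) : ℝ :=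
  -∑ i, p i * Real.log (p i)

/-- Gibbs' inequality: the entropy is at most the cross-entropy. -/
theorem shannonEntropy_le_crossEntropy {m : ℕ} {p q : Fin m → ℝ} (hp : ∀ i, 0 < p i)
    (hq : ∀ i, 0 < q i) (hpq : ∑ i, q i ≤ ∑ i, p i) :
    shannonEntropy p ≤ -∑ i, p i * Real.log (q i) := by
  have h : ∑ i, (p i * Real.log (q i) - p i * Real.log (p i)) ≤ ∑ i, (q i - p i) := by
    refine Finset.sum_le_sum fun i _ => ?_
    have hlog := Real.log_le_sub_one_of_pos (div_pos (hq i) (hp i))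
    rw [Real.log_div (hq i).ne' (hp i).ne'] at hlog
    calc p i * Real.log (q i) - p i * Real.log (p i)
        = p i * (Real.log (q i) - Real.log (p i)) := by ring
      _ ≤ p i * (q i / p i - 1) := mul_le_mul_of_nonneg_left hlog (hp i).le
      _ = q i - p i := by have := (hp i).ne'; field_simp
  rw [Finset.sum_sub_distrib, Finset.sum_sub_distrib] at h
  unfold shannonEntropy
  linarith

theorem sum_exp_pos {m : ℕ} (hm : 1 ≤ m) (f : Fin m → ℝ) : 0 < ∑ i, Real.exp (f i) :=
  Finset.sum_pos (fun _ _ => Real.exp_pos _) ⟨⟨0, hm⟩, Finset.mem_univ _⟩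

theorem softmax_pos {m : ℕ} (hm : 1 ≤ m) (β : ℝ) (μ : Fin m → ℝ) (i : Fin m) :
    0 < softmax β μ i :=
  div_pos (Real.exp_pos _) (sum_exp_pos hm _)

theorem sum_softmax {m : ℕ} (hm : 1 ≤ m) (β : ℝ) (μ : Fin m → ℝ) :
    ∑ i, softmax β μ i = 1 := by
  simp only [softmax, ← Finset.sum_div]
  exact div_self (sum_exp_pos hm _).ne'

/-- The cross-entropy of a probability vector relative to a softmax distribution is the
log-partition function minus `β` times the mean logit. -/
theorem neg_sum_mul_log_softmax {m : ℕ} (hm : 1 ≤ m) (β : ℝ) (μ p : Fin m → ℝ)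
    (hp : ∑ i, p i = 1) :
    -∑ i, p i * Real.log (softmax β μ i) =
      Real.log (∑ j, Real.exp (β * μ j)) - β * ∑ i, p i * μ i := by
  have h (i : Fin m) : p i * Real.log (softmax β μ i) =
      β * (p i * μ i) - p i * Real.log (∑ j, Real.exp (β * μ j)) := by
    rw [softmax, Real.log_div (Real.exp_pos _).ne' (sum_exp_pos hm _).ne', Real.log_exp]
    ring
  simp only [h, Finset.sum_sub_distrib, ← Finset.mul_sum, ← Finset.sum_mul, hp]
  ring

theorem shannonEntropy_softmax_le {m : ℕ} (hm : 1 ≤ m) (μ : Fin m → ℝ) {β₁ β₂ : ℝ}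
    (h₀ : 0 ≤ β₁) (h : β₁ ≤ β₂) :
    shannonEntropy (softmax β₂ μ) ≤ shannonEntropy (softmax β₁ μ) := by
  obtain rfl | hlt := h.eq_or_lt
  · exact le_rfl
  have gibbs (a b : ℝ) := shannonEntropy_le_crossEntropy (softmax_pos hm a μ)
    (softmax_pos hm b μ) (by rw [sum_softmax hm, sum_softmax hm])
  have h₁₂ := gibbs β₁ β₂
  have h₂₁ := gibbs β₂ β₁
  unfold shannonEntropy at *
  simp only [neg_sum_mul_log_softmax hm _ _ _ (sum_softmax hm _ μ)] at *
  have hmean : ∑ i, softmax β₁ μ i * μ i ≤ ∑ i, softmax β₂ μ i * μ i :=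
    le_of_mul_le_mul_left (by linarith) (sub_pos.2 hlt)
  linarith [mul_le_mul_of_nonneg_left hmean h₀]

/-- The entropy of the softmax distribution is antitone in the inverse temperature on
`[0, ∞)`; in particular, for every `τ ≥ 1` the flattened distribution `softmax (1/τ) μ`
(logits `μ/τ`) has entropy at least that of `softmax 1 μ` (logits `μ`). -/
theorem softmax_entropy_antitone {m : ℕ} (hm : 1 ≤ m) (μ : Fin m → ℝ) :
    (∀ β₁ β₂ : ℝ, 0 ≤ β₁ → β₁ ≤ β₂ →
      shannonEntropy (softmax β₂ μ) ≤ shannonEntropy (softmax β₁ μ)) ∧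
    (∀ τ : ℝ, 1 ≤ τ →
      shannonEntropy (softmax 1 μ) ≤ shannonEntropy (softmax (1 / τ) μ)) := by
  refine ⟨fun β₁ β₂ h₀ h => shannonEntropy_softmax_le hm μ h₀ h, fun τ hτ => ?_⟩
  have hτ₀ : 0 < τ := one_pos.trans_le hτ
  exact shannonEntropy_softmax_le hm μ (by positivity) ((div_le_one hτ₀).2 hτ)
end

section
/- Let δ > 0. The map s ↦ ∫ (1 + exp(−x))⁻¹ dG_{δ,s²}(x), where G_{δ,s²} is the real Gaussian measure with mean δ and variance s², is strictly antitone on (0, ∞), and its value at every s > 0 is strictly less than (1 + exp(−δ))⁻¹ (its value at s = 0). (In the two-response model with logits z ~ N(μ, σ²I) and response drawn from Categorical(softmax(z)), the probability of the mode response equals this integral with δ = μ(0) − μ(1) and s² = 2σ², hence it strictly decreases as the logit variance grows.) -/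
open MeasureTheory ProbabilityTheory

lemma integrable_sigmoid_comp {μ : Measure ℝ} [IsFiniteMeasure μ] {f : ℝ → ℝ}
    (hf : Measurable f) : Integrable (fun x => Real.sigmoid (f x)) μ := by
  refine Integrable.of_bound
    (continuous_sigmoid.measurable.comp hf).aestronglyMeasurable 1 (.of_forall fun x => ?_)
  rw [Real.norm_of_nonneg (Real.sigmoid_nonneg _)]
  exact Real.sigmoid_le_one _

/-- The mean of `f` at two points symmetric about `x > 0` lies strictly below `f x` for `f` the
logistic sigmoid, although the sigmoid is not concave on all of `ℝ`. -/
lemma sigmoid_add_sigmoid_sub_lt {x y : ℝ} (hx : 0 < x) (hy : y ≠ 0) :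
    Real.sigmoid (x + y) + Real.sigmoid (x - y) < 2 * Real.sigmoid x := by
  have ha : Real.exp (-x) < 1 := Real.exp_lt_one_iff.2 (by linarith)
  have hc : 1 < Real.cosh y := Real.one_lt_cosh.2 hy
  rw [Real.cosh_eq] at hc
  have hbd : Real.exp y * Real.exp (-y) = 1 := by rw [← Real.exp_add]; simp
  have h1 : Real.exp (-(x + y)) = Real.exp (-x) * Real.exp (-y) := by rw [← Real.exp_add]; ring_nf
  have h2 : Real.exp (-(x - y)) = Real.exp (-x) * Real.exp y := by rw [← Real.exp_add]; ring_nf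
  rw [Real.sigmoid_def, Real.sigmoid_def, Real.sigmoid_def, h1, h2]
  have ha0 := Real.exp_pos (-x)
  have hb0 := Real.exp_pos y
  have hd0 := Real.exp_pos (-y)
  generalize Real.exp (-x) = a at *
  generalize Real.exp y = b at *
  generalize Real.exp (-y) = d at *
  have key : 2 * (1 + a)⁻¹ - ((1 + a * d)⁻¹ + (1 + a * b)⁻¹)
      = a * (1 - a) * (b + d - 2) / ((1 + a) * (1 + a * d) * (1 + a * b)) := by
    field_simp
    linear_combination 2 * a ^ 2 * hbd
  have : 0 < a * (1 - a) * (b + d - 2) / ((1 + a) * (1 + a * d) * (1 + a * b)) := by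
    have : 0 < 1 - a := by linarith
    have : 0 < b + d - 2 := by linarith
    positivity
  linarith

lemma integral_comp_neg_gaussianReal (f : ℝ → ℝ) (m : ℝ) (v : NNReal) :
    ∫ x, f (-x) ∂(gaussianReal m v) = ∫ x, f x ∂(gaussianReal (-m) v) := by
  rw [← gaussianReal_map_neg]
  exact ((MeasurableEquiv.neg ℝ).measurableEmbedding.integral_map f).symm

lemma gaussianPDFReal_neg_mean_lt {δ x : ℝ} {v : NNReal} (hδ : 0 < δ) (hv : v ≠ 0) (hx : 0 < x) :
    gaussianPDFReal (-δ) v x < gaussianPDFReal δ v x := by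
  have hv' : (0 : ℝ) < v := by positivity
  rw [gaussianPDFReal, gaussianPDFReal]
  gcongr ?_ * Real.exp (?_ / _)
  nlinarith [mul_pos hδ hx]

lemma gaussianPDFReal_neg_neg (m : ℝ) (v : NNReal) (x : ℝ) :
    gaussianPDFReal (-m) v (-x) = gaussianPDFReal m v x := by
  rw [gaussianPDFReal, gaussianPDFReal]
  ring_nf

/-- A bounded odd function, positive on the positive half-line, has positive expectation under
every Gaussian measure of positive mean. -/
lemma integral_gaussianReal_pos_of_odd {g : ℝ → ℝ} {C δ : ℝ} (v : NNReal)
    (hg : Measurable g) (hC : ∀ x, |g x| ≤ C) (hodd : ∀ x, g (-x) = -g x)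
    (hpos : ∀ x, 0 < x → 0 < g x) (hδ : 0 < δ) : 0 < ∫ x, g x ∂(gaussianReal δ v) := by
  rcases eq_or_ne v 0 with rfl | hv
  · simpa using hpos δ hδ
  have hneg : ∫ x, g x ∂(gaussianReal (-δ) v) = -∫ x, g x ∂(gaussianReal δ v) := by
    simp_rw [← integral_comp_neg_gaussianReal, hodd, integral_neg]
  have hint (m : ℝ) : Integrable (fun x => gaussianPDFReal m v x • g x) :=
    (integrable_gaussianPDFReal m v).mul_bdd hg.aestronglyMeasurable
      (.of_forall hC)
  have hgt (x : ℝ) (hx : 0 < x) :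
      0 < gaussianPDFReal δ v x • g x - gaussianPDFReal (-δ) v x • g x := by
    rw [← sub_smul]
    exact mul_pos (sub_pos.2 (gaussianPDFReal_neg_mean_lt hδ hv hx)) (hpos x hx)
  have hnonneg (x : ℝ) :
      0 ≤ gaussianPDFReal δ v x • g x - gaussianPDFReal (-δ) v x • g x := by
    rcases lt_trichotomy x 0 with hx | rfl | hx
    · have h := hgt (-x) (by linarith)
      have h1 := gaussianPDFReal_neg_neg δ v x
      have h2 := gaussianPDFReal_neg_neg (-δ) v x
      rw [neg_neg] at h2
      rw [h1, h2, hodd] at h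
      simp only [smul_eq_mul] at h ⊢
      linarith
    · have h := hodd 0
      rw [neg_zero] at h
      have : g 0 = 0 := by linarith
      simp [this]
    · exact (hgt x hx).le
  have h : 0 < ∫ x, (gaussianPDFReal δ v x • g x - gaussianPDFReal (-δ) v x • g x) := by
    rw [integral_pos_iff_support_of_nonneg hnonneg ((hint δ).sub (hint (-δ)))]
    exact lt_of_lt_of_le (by simp) (measure_mono fun x (hx : x ∈ Set.Ioi 0) => (hgt x hx).ne')
  rw [integral_sub (hint δ) (hint (-δ)), ← integral_gaussianReal_eq_integral_smul hv,
    ← integral_gaussianReal_eq_integral_smul hv, hneg] at h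
  linarith

lemma integral_sigmoid_sub_gaussianReal (x : ℝ) (w : NNReal) :
    ∫ y, Real.sigmoid (x - y) ∂(gaussianReal 0 w) =
      ∫ y, Real.sigmoid (x + y) ∂(gaussianReal 0 w) := by
  simpa [sub_eq_add_neg] using
    integral_comp_neg_gaussianReal (fun y => Real.sigmoid (x + y)) 0 w

lemma integral_sigmoid_add_gaussianReal_lt {x : ℝ} {w : NNReal} (hx : 0 < x) (hw : w ≠ 0) :
    ∫ y, Real.sigmoid (x + y) ∂(gaussianReal 0 w) < Real.sigmoid x := by
  have hadd : Integrable (fun y => Real.sigmoid (x + y)) (gaussianReal 0 w) :=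
    integrable_sigmoid_comp (by fun_prop)
  have hsub : Integrable (fun y => Real.sigmoid (x - y)) (gaussianReal 0 w) :=
    integrable_sigmoid_comp (by fun_prop)
  have hsum : Integrable (fun y => Real.sigmoid (x + y) + Real.sigmoid (x - y))
      (gaussianReal 0 w) := hadd.add hsub
  have hlt : 0 < ∫ y, (2 * Real.sigmoid x - (Real.sigmoid (x + y) + Real.sigmoid (x - y)))
      ∂(gaussianReal 0 w) := by
    have hgt (y : ℝ) (hy : y ≠ 0) :=
      sub_pos.2 (sigmoid_add_sigmoid_sub_lt hx hy)
    refine (integral_pos_iff_support_of_nonneg ?_ ((integrable_const _).sub hsum)).2 ?_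
    rotate_left
    · have := nullSingletonClass_gaussianReal (μ := 0) hw
      refine lt_of_lt_of_le ?_ (measure_mono fun y (hy : y ∈ ({0} : Set ℝ)ᶜ) => (hgt y hy).ne')
      rw [prob_compl_eq_one_sub (measurableSet_singleton 0)]
      simp
    · intro y
      rcases eq_or_ne y 0 with rfl | hy
      · simp [two_mul]
      · exact (hgt y hy).le
  rw [integral_sub (integrable_const _) hsum, integral_add hadd hsub,
    integral_sigmoid_sub_gaussianReal] at hlt
  simp only [integral_const, probReal_univ, one_smul] at hlt
  linarith

lemma integral_sigmoid_neg_add_gaussianReal (x : ℝ) (w : NNReal) :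
    ∫ y, Real.sigmoid (-x + y) ∂(gaussianReal 0 w) =
      1 - ∫ y, Real.sigmoid (x + y) ∂(gaussianReal 0 w) := by
  have h (y : ℝ) : Real.sigmoid (-x + y) = 1 - Real.sigmoid (x - y) := by
    rw [← Real.sigmoid_neg]; ring_nf
  simp_rw [h]
  rw [integral_sub (integrable_const _) (integrable_sigmoid_comp (by fun_prop)),
    integral_sigmoid_sub_gaussianReal]
  simp

/-- For positive mean, the Gaussian expectation of the sigmoid is strictly decreasing in the
variance, the degenerate variance `0` included. -/
lemma strictAnti_integral_sigmoid_gaussianReal {δ : ℝ} (hδ : 0 < δ) :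
    StrictAnti fun v : NNReal => ∫ x, Real.sigmoid x ∂(gaussianReal δ v) := by
  intro v u hvu
  obtain ⟨w, rfl⟩ := exists_add_of_le hvu.le
  have hw : w ≠ 0 := by rintro rfl; simp at hvu
  have hmeas : Measurable fun x => ∫ y, Real.sigmoid (x + y) ∂(gaussianReal 0 w) := by
    have : StronglyMeasurable (Function.uncurry fun x y : ℝ => Real.sigmoid (x + y)) :=
      (continuous_sigmoid.comp continuous_add).stronglyMeasurable
    exact this.integral_prod_right.measurable
  have h0 (x : ℝ) : 0 ≤ ∫ y, Real.sigmoid (x + y) ∂(gaussianReal 0 w) :=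
    integral_nonneg fun y => Real.sigmoid_nonneg _
  have h1 (x : ℝ) : ∫ y, Real.sigmoid (x + y) ∂(gaussianReal 0 w) ≤ 1 := by
    have := integral_mono (μ := gaussianReal 0 w) (f := fun y => Real.sigmoid (x + y))
      (integrable_sigmoid_comp (by fun_prop)) (integrable_const 1)
      fun y => Real.sigmoid_le_one _
    simpa using this
  have hconv : ∫ x, Real.sigmoid x ∂(gaussianReal δ (v + w)) =
      ∫ x, ∫ y, Real.sigmoid (x + y) ∂(gaussianReal 0 w) ∂(gaussianReal δ v) := by
    have h := gaussianReal_conv_gaussianReal (m₁ := δ) (m₂ := 0) (v₁ := v) (v₂ := w)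
    rw [add_zero] at h
    rw [← h, integral_conv (integrable_sigmoid_comp measurable_id')]
  have hpos := integral_gaussianReal_pos_of_odd (C := 1) v
    (g := fun x => Real.sigmoid x - ∫ y, Real.sigmoid (x + y) ∂(gaussianReal 0 w))
    (continuous_sigmoid.measurable.sub hmeas)
    (fun x => abs_sub_le_iff.2 ⟨by linarith [h0 x, Real.sigmoid_le_one x],
      by linarith [h1 x, Real.sigmoid_nonneg x]⟩)
    (fun x => by rw [integral_sigmoid_neg_add_gaussianReal, Real.sigmoid_neg]; ring)
    (fun x hx => sub_pos.2 (integral_sigmoid_add_gaussianReal_lt hx hw)) hδ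
  rw [integral_sub (integrable_sigmoid_comp measurable_id')
    (Integrable.of_bound hmeas.aestronglyMeasurable 1 (.of_forall fun x => by
      rw [Real.norm_of_nonneg (h0 x)]; exact h1 x)), ← hconv] at hpos
  exact sub_pos.1 hpos

/-- In the two-response logit model, the probability of the mode response equals the
expectation of the logistic sigmoid under a Gaussian with mean `δ > 0` and variance `s²`.
This map is strictly antitone in `s` on `(0, ∞)`, and its value at every `s > 0` is
strictly less than its value `(1 + exp(-δ))⁻¹` at `s = 0`. -/
theorem sigmoid_gaussian_expectation_strictAnti (δ : ℝ) (hδ : 0 < δ) :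
    StrictAntiOn
      (fun s : ℝ => ∫ x, (1 + Real.exp (-x))⁻¹
        ∂(gaussianReal δ (Real.toNNReal (s ^ 2)))) (Set.Ioi 0) ∧
    ∀ s : ℝ, 0 < s →
      (∫ x, (1 + Real.exp (-x))⁻¹ ∂(gaussianReal δ (Real.toNNReal (s ^ 2))))
        < (1 + Real.exp (-δ))⁻¹ := by
  simp_rw [← Real.sigmoid_def]
  have hanti := strictAnti_integral_sigmoid_gaussianReal hδ
  refine ⟨fun s hs t ht hst => hanti ?_, fun s hs => ?_⟩
  · rw [Set.mem_Ioi] at hs ht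
    exact (Real.toNNReal_lt_toNNReal_iff (by positivity)).2 (by gcongr)
  · simpa using hanti (show 0 < Real.toNNReal (s ^ 2) from Real.toNNReal_pos.2 (by positivity))
end

section
/- Let γ be the Borel probability measure on ℝ with density x ↦ exp(−x − exp(−x)) with respect to Lebesgue measure (the standard Gumbel distribution). Let m ≥ 1, z : Fin m → ℝ and k : Fin m. Under the product measure ⊗_{i ∈ Fin m} γ on Fin m → ℝ, the probability of the event {g : ∀ j ≠ k, z(k) + g(k) > z(j) + g(j)} equals exp(z(k)) / ∑_j exp(z(j)). (Gumbel-max trick: perturbing the logits by independent standard Gumbel noise and taking the argmax samples exactly from Categorical(softmax(z)).) -/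
open MeasureTheory

open Filter Set Topology

/-- The standard Gumbel density is integrable. -/
lemma integrable_gumbel_density
    [IsProbabilityMeasure
      (volume.withDensity fun x : ℝ => ENNReal.ofReal (Real.exp (-x - Real.exp (-x))))] :
    Integrable fun x : ℝ => Real.exp (-x - Real.exp (-x)) := by
  refine (lintegral_ofReal_ne_top_iff_integrable
    (by fun_prop) (ae_of_all _ fun x => (Real.exp_pos _).le)).1 ?_
  rw [← setLIntegral_univ, ← withDensity_apply _ MeasurableSet.univ, measure_univ]
  exact ENNReal.one_ne_top

/-- The cumulative distribution function of the standard Gumbel distribution. -/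
lemma gumbel_Iio (γ : Measure ℝ) [IsProbabilityMeasure γ]
    (hγ : γ = volume.withDensity fun x => ENNReal.ofReal (Real.exp (-x - Real.exp (-x))))
    (a : ℝ) : γ (Iio a) = ENNReal.ofReal (Real.exp (-Real.exp (-a))) := by
  subst hγ
  have hint := integrable_gumbel_density.integrableOn (s := Iic a)
  have hderiv (x : ℝ) : HasDerivAt (fun x => Real.exp (-Real.exp (-x)))
      (Real.exp (-x - Real.exp (-x))) x := by
    refine (hasDerivAt_neg x).exp.neg.exp.congr_deriv ?_
    rw [sub_eq_add_neg, Real.exp_add, Pi.neg_apply]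
    ring
  have hlim : Tendsto (fun x => Real.exp (-Real.exp (-x))) atBot (𝓝 0) :=
    Real.tendsto_exp_neg_atTop_nhds_zero.comp
      (Real.tendsto_exp_atTop.comp tendsto_neg_atBot_atTop)
  rw [withDensity_apply _ measurableSet_Iio, setLIntegral_congr Iio_ae_eq_Iic,
    ← ofReal_integral_eq_lintegral_ofReal hint (ae_of_all _ fun x => (Real.exp_pos _).le),
    integral_Iic_of_hasDerivAt_of_tendsto' (fun x _ => hderiv x) hint hlim, sub_zero]

/-- The total mass of the Gumbel density tilted by a factor `s` in the inner exponential. -/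
lemma lintegral_exp_neg_sub_mul_exp_neg (γ : Measure ℝ) [IsProbabilityMeasure γ]
    (hγ : γ = volume.withDensity fun x => ENNReal.ofReal (Real.exp (-x - Real.exp (-x))))
    {s : ℝ} (hs : 0 < s) :
    ∫⁻ x : ℝ, ENNReal.ofReal (Real.exp (-x - s * Real.exp (-x))) = ENNReal.ofReal s⁻¹ := by
  have hshift (x : ℝ) : ENNReal.ofReal (Real.exp (-x - s * Real.exp (-x))) =
      ENNReal.ofReal s⁻¹ *
        ENNReal.ofReal (Real.exp (-(x - Real.log s) - Real.exp (-(x - Real.log s)))) := by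
    rw [← ENNReal.ofReal_mul (inv_nonneg.2 hs.le)]
    congr 1
    rw [neg_sub, Real.exp_sub (Real.log s) x, Real.exp_log hs, Real.exp_sub, Real.exp_sub,
      Real.exp_sub, Real.exp_log hs, Real.exp_neg x]
    field_simp
  have hmass : ∫⁻ x : ℝ, ENNReal.ofReal (Real.exp (-x - Real.exp (-x))) = 1 := by
    rw [← setLIntegral_univ, ← withDensity_apply _ MeasurableSet.univ, ← hγ, measure_univ]
  simp_rw [hshift]
  rw [lintegral_const_mul _ (by fun_prop), lintegral_sub_right_eq_self
    (fun x => ENNReal.ofReal (Real.exp (-x - Real.exp (-x)))) (Real.log s), hmass, mul_one]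

/-- Gumbel-max trick: let `γ` be the standard Gumbel distribution, i.e. the Borel
probability measure on `ℝ` with density `x ↦ exp(-x - exp(-x))` with respect to Lebesgue
measure. Under the product measure `⊗_{i ∈ Fin m} γ`, the probability that the perturbed
logit `z k + g k` strictly exceeds every other perturbed logit `z j + g j` equals
`softmax(z)(k) = exp(z k) / ∑ j, exp(z j)`. -/
theorem gumbel_max_trick {m : ℕ} (hm : 1 ≤ m) (z : Fin m → ℝ) (k : Fin m)
    (γ : Measure ℝ) [IsProbabilityMeasure γ]
    (hγ : γ = volume.withDensity fun x => ENNReal.ofReal (Real.exp (-x - Real.exp (-x)))) :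
    (Measure.pi fun _ : Fin m => γ) {g | ∀ j, j ≠ k → z j + g j < z k + g k}
      = ENNReal.ofReal (Real.exp (z k) / ∑ j, Real.exp (z j)) := by
  obtain ⟨n, rfl⟩ := Nat.exists_eq_add_of_le' hm
  let A : Set (ℝ × (Fin n → ℝ)) := {p | ∀ j, z (k.succAbove j) + p.2 j < z k + p.1}
  have hA : MeasurableSet A := by
    simp only [A, ofPred_forall]
    exact MeasurableSet.iInter fun j => measurableSet_lt (by fun_prop) (by fun_prop)
  have hpre : {g : Fin (n + 1) → ℝ | ∀ j, j ≠ k → z j + g j < z k + g k} =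
      MeasurableEquiv.piFinSuccAbove (fun _ => ℝ) k ⁻¹' A := by
    ext g
    simp only [mem_ofPred_eq, Fin.forall_iff_succAbove k, ne_eq, not_true_eq_false,
      false_implies, Fin.succAbove_ne, not_false_eq_true, true_implies, true_and]
    rfl
  have hslice (x : ℝ) : (Measure.pi fun _ : Fin n => γ) (Prod.mk x ⁻¹' A) =
      ENNReal.ofReal (Real.exp
        (-((∑ j, Real.exp (z (k.succAbove j) - z k)) * Real.exp (-x)))) := by
    have hpi : Prod.mk x ⁻¹' A =
        Set.pi univ fun j => Iio (z k + x - z (k.succAbove j)) := by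
      ext h
      simp [A, lt_sub_iff_add_lt']
    rw [hpi, Measure.pi_pi]
    simp_rw [gumbel_Iio γ hγ]
    rw [← ENNReal.ofReal_prod_of_nonneg fun j _ => (Real.exp_pos _).le, ← Real.exp_sum,
      Finset.sum_neg_distrib, Finset.sum_mul]
    simp_rw [← Real.exp_add]
    congr! 5
    ring_nf
  have hsum : ∑ j, Real.exp (z j - z k) = 1 + ∑ j, Real.exp (z (k.succAbove j) - z k) := by
    rw [Fin.sum_univ_succAbove _ k, sub_self, Real.exp_zero]
  have hpos : 0 < ∑ j, Real.exp (z j - z k) :=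
    Finset.sum_pos (fun j _ => Real.exp_pos _) ⟨k, Finset.mem_univ k⟩
  rw [hpre, (measurePreserving_piFinSuccAbove (fun _ => γ) k).measure_preimage
    hA.nullMeasurableSet, Measure.prod_apply hA]
  simp_rw [hslice]
  have hdens : ∫⁻ x, ENNReal.ofReal (Real.exp
        (-((∑ j, Real.exp (z (k.succAbove j) - z k)) * Real.exp (-x)))) ∂γ =
      ∫⁻ x, ENNReal.ofReal (Real.exp (-x - (∑ j, Real.exp (z j - z k)) * Real.exp (-x))) := by
    rw [hγ, lintegral_withDensity_eq_lintegral_mul _ (by fun_prop) (by fun_prop)]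
    refine lintegral_congr fun x => ?_
    rw [Pi.mul_apply, ← ENNReal.ofReal_mul (Real.exp_pos _).le, ← Real.exp_add, hsum]
    congr 2
    ring
  rw [hdens, lintegral_exp_neg_sub_mul_exp_neg γ hγ hpos]
  simp_rw [Real.exp_sub]
  rw [← Finset.sum_div, inv_div]
end
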